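/- arXiv:2007.10772 — 3 statements merged into one kernel-verified Lean document; each statement's English description precedes it below -/
import Mathlib

section
/- For every integer n ≥ 1 and all indices 1 ≤ i < j ≤ n, the element ρ_i ρ_n^i ρ_{j−i} = ρ_j ρ_n^i of M_n is the right-lcm of ρ_i and ρ_j: both ρ_i and ρ_j left-divide it, and it left-divides every element of M_n that is left-divided by both ρ_i and ρ_j. -/
/-- The defining relations of the monoid `M_n`: the generator `k : Fin n` represents `ρ_{k+1}`
(so that `ρ_i` corresponds to the index `i - 1`), and the relations are
`ρ_1 ρ_n ρ_i = ρ_{i+1} ρ_n` for `1 ≤ i ≤ n - 1`. -/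
inductive MnRel (n : ℕ) : FreeMonoid (Fin n) → FreeMonoid (Fin n) → Prop
  | rel (i : ℕ) (h1 : 1 ≤ i) (h2 : i ≤ n - 1) :
      MnRel n
        (FreeMonoid.of ⟨1 - 1, by omega⟩ * FreeMonoid.of ⟨n - 1, by omega⟩ *
          FreeMonoid.of ⟨i - 1, by omega⟩)
        (FreeMonoid.of ⟨i + 1 - 1, by omega⟩ * FreeMonoid.of ⟨n - 1, by omega⟩)

/-- The presented monoid `M_n`. -/
abbrev Mn (n : ℕ) := PresentedMonoid (MnRel n)

/-- The generator `ρ_i` of `M_n`, for `1 ≤ i ≤ n` (junk value `1` out of range). -/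
def rho (n : ℕ) (i : ℕ) : Mn n :=
  if h : 1 ≤ i ∧ i ≤ n then PresentedMonoid.of (MnRel n) ⟨i - 1, by omega⟩ else 1

/-- `a` left-divides `c`: `c = a * b` for some `b`. -/
def LDvd {M : Type*} [Monoid M] (a c : M) : Prop := ∃ b, a * b = c

/-- `a` right-divides `c`: `c = b * a` for some `b`. -/
def RDvd {M : Type*} [Monoid M] (a c : M) : Prop := ∃ b, b * a = c

theorem rho_rel (n m : ℕ) (h1 : 1 ≤ m) (h2 : m + 1 ≤ n) :
    rho n 1 * rho n n * rho n m = rho n (m + 1) * rho n n := by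
  have h := PresentedMonoid.mk_eq_mk_of_rel (MnRel.rel (n := n) m h1 (by omega))
  have e1 : 1 ≤ n := by omega
  have e2 : m ≤ n := by omega
  simp only [rho, h1, h2, e1, e2, le_refl, true_and, dif_pos, le_add_iff_nonneg_left, zero_le]
  exact h

theorem rho_id (n i : ℕ) (hi : 1 ≤ i) : ∀ j, i < j → j ≤ n →
    rho n i * (rho n n) ^ i * rho n (j - i) = rho n j * (rho n n) ^ i := by
  induction i, hi using Nat.le_induction with
  | base =>
    intro j hij hj
    have := rho_rel n (j - 1) (by omega) (by omega)
    rw [Nat.sub_add_cancel (by omega)] at this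
    simpa using this
  | succ i hi ih =>
    intro j hij hj
    have h1 := ih (j - 1) (by omega) (by omega)
    have h2 := rho_rel n (j - 1) (by omega) (by omega)
    have h3 := rho_rel n i (by omega) (by omega)
    rw [Nat.sub_add_cancel (by omega)] at h2
    have e : j - (i + 1) = j - 1 - i := by omega
    rw [e, pow_succ', ← mul_assoc, ← h3, ← mul_assoc, ← h2]
    simp only [mul_assoc] at h1 ⊢
    rw [h1]

theorem wt_aux (n : ℕ) : ∀ a b : FreeMonoid (Fin n), MnRel n a b →
    FreeMonoid.lift (fun k : Fin n => Multiplicative.ofAdd (k.val + 1)) a =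
    FreeMonoid.lift (fun k : Fin n => Multiplicative.ofAdd (k.val + 1)) b := by
  rintro _ _ ⟨i, h1, h2⟩
  simp only [map_mul, FreeMonoid.lift_eval_of, ← ofAdd_add]
  congr 1
  omega

def wtHom (n : ℕ) : Mn n →* Multiplicative ℕ :=
  PresentedMonoid.lift (fun k : Fin n => Multiplicative.ofAdd (k.val + 1)) (wt_aux n)

def wt (n : ℕ) (x : Mn n) : ℕ := Multiplicative.toAdd (wtHom n x)

theorem wt_mul (n : ℕ) (x y : Mn n) : wt n (x * y) = wt n x + wt n y := by
  simp [wt]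

theorem wt_rho (n i : ℕ) (h1 : 1 ≤ i) (h2 : i ≤ n) : wt n (rho n i) = i := by
  simp only [rho, h1, h2, and_self, dif_pos]
  change i - 1 + 1 = i
  omega

def Cl (n : ℕ) (i : ℕ) (U : Mn n) (j : ℕ) (V : Mn n) : Prop :=
  (i = j ∧ U = V) ∨
  (i < j ∧ ∃ s, U = rho n n ^ i * (rho n (j - i) * s) ∧ V = rho n n ^ i * s) ∨
  (j < i ∧ ∃ s, V = rho n n ^ j * (rho n (i - j) * s) ∧ U = rho n n ^ j * s)

def IHyp (n N : ℕ) : Prop := ∀ i j U V, 1 ≤ i → i ≤ n → 1 ≤ j → j ≤ n →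
  rho n i * U = rho n j * V → wt n (rho n i * U) < N → Cl n i U j V

theorem IHyp.cancel {n N : ℕ} (h : IHyp n N) (hn : 1 ≤ n) (U V : Mn n)
    (e : rho n n * U = rho n n * V) (w : wt n (rho n n * U) < N) : U = V := by
  rcases h n n U V hn le_rfl hn le_rfl e w with h | h | h
  · exact h.2
  · omega
  · omega

/-- from head `ρ_1` to head `ρ_{m+1}` -/
theorem caseA {n N : ℕ} (h : IHyp n N) (i m : ℕ) (hi : 1 ≤ i) (hin : i ≤ n) (hm : 1 ≤ m)
    (hmn : m + 1 ≤ n) (U t : Mn n) (hw : wt n (rho n n * (rho n m * t)) < N)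
    (hC : Cl n i U 1 (rho n n * (rho n m * t))) : Cl n i U (m + 1) (rho n n * t) := by
  rcases hC with ⟨rfl, rfl⟩ | ⟨h1, _⟩ | ⟨h1, x, hV, rfl⟩
  · right; left
    exact ⟨by omega, t, by simp, by simp⟩
  · omega
  · rw [pow_one] at *
    have e := h.cancel (by omega) _ _ hV hw
    have hw' : wt n (rho n m * t) < N := by rw [wt_mul] at hw; omega
    rcases h m (i - 1) t x hm (by omega) (by omega) (by omega) e hw' with
      ⟨h2, rfl⟩ | ⟨h2, s, rfl, rfl⟩ | ⟨h2, s, rfl, rfl⟩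
    · left; exact ⟨by omega, rfl⟩
    · right; right
      refine ⟨by omega, s, ?_, ?_⟩
      · rw [pow_succ', mul_assoc, show i - (m + 1) = i - 1 - m by omega]
      · rw [pow_succ', mul_assoc]
    · right; left
      obtain ⟨k, rfl⟩ : ∃ k, i = k + 1 := ⟨i - 1, by omega⟩
      refine ⟨by omega, s, ?_, ?_⟩
      · rw [pow_succ', mul_assoc, show m + 1 - (k + 1) = m - (k + 1 - 1) by omega]; rfl
      · rw [pow_succ', mul_assoc]; rfl

/-- from head `ρ_{m+1}` to head `ρ_1` -/
theorem caseB {n N : ℕ} (h : IHyp n N) (i m : ℕ) (hi : 1 ≤ i) (hin : i ≤ n) (hm : 1 ≤ m)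
    (hmn : m + 1 ≤ n) (U t : Mn n) (hw : wt n (rho n n * t) < N)
    (hC : Cl n i U (m + 1) (rho n n * t)) : Cl n i U 1 (rho n n * (rho n m * t)) := by
  obtain ⟨k, rfl⟩ : ∃ k, i = k + 1 := ⟨i - 1, by omega⟩
  rcases hC with ⟨h1, rfl⟩ | ⟨h1, s, rfl, hV⟩ | ⟨h1, s, hV, rfl⟩
  · right; right
    refine ⟨by omega, t, ?_, by simp⟩
    rw [pow_one, show k + 1 - 1 = m by omega]
  · rw [pow_succ', mul_assoc] at hV
    have e := h.cancel (by omega) _ _ hV hw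
    subst e
    rcases Nat.eq_zero_or_pos k with rfl | hk
    · left; simp
    · right; right
      refine ⟨by omega, rho n n ^ k * (rho n (m - k) * s), ?_, ?_⟩
      · have := rho_id n k hk m (by omega) (by omega)
        have e2 : rho n m * (rho n n ^ k * s) = rho n k * (rho n n ^ k * (rho n (m - k) * s)) := by
          rw [← mul_assoc, ← this]; simp only [mul_assoc]
        rw [e2, pow_one]; rfl
      · rw [pow_succ', pow_one, mul_assoc, show m + 1 - (k + 1) = m - k by omega]
  · rw [pow_succ', mul_assoc] at hV
    have e := h.cancel (by omega) _ _ hV hw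
    subst e
    right; right
    refine ⟨by omega, rho n n ^ m * s, ?_, ?_⟩
    · have := rho_id n m hm k (by omega) (by omega)
      have e2 : rho n m * (rho n n ^ m * (rho n (k - m) * s)) = rho n k * (rho n n ^ m * s) := by
        rw [← mul_assoc (rho n k), ← this]; simp only [mul_assoc]
      rw [show k + 1 - (m + 1) = k - m by omega, e2, pow_one]; rfl
    · rw [pow_succ', pow_one, mul_assoc]

abbrev mkM (n : ℕ) (x : FreeMonoid (Fin n)) : Mn n := PresentedMonoid.mk (MnRel n) x

theorem mkM_mul (n : ℕ) (x y : FreeMonoid (Fin n)) : mkM n (x * y) = mkM n x * mkM n y :=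
  map_mul _ _ _

theorem mkM_of (n k : ℕ) (hk : k < n) : mkM n (FreeMonoid.of ⟨k, hk⟩) = rho n (k + 1) := by
  have : 1 ≤ k + 1 ∧ k + 1 ≤ n := by omega
  rw [rho, dif_pos this]; rfl

/-- claim for a word -/
def CW (n i : ℕ) (U : Mn n) (w : FreeMonoid (Fin n)) : Prop :=
  ∃ (k : Fin n) (v : FreeMonoid (Fin n)), w = FreeMonoid.of k * v ∧ Cl n i U (k.val + 1) (mkM n v)

theorem CW_iff (n i : ℕ) (U : Mn n) (k : Fin n) (v : FreeMonoid (Fin n)) :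
    CW n i U (FreeMonoid.of k * v) ↔ Cl n i U (k.val + 1) (mkM n v) := by
  constructor
  · rintro ⟨k', v', h, hc⟩
    have h' := congrArg FreeMonoid.toList h
    simp only [FreeMonoid.toList_of_mul, List.cons.injEq] at h'
    obtain ⟨rfl, h2⟩ := h'
    have : v = v' := FreeMonoid.toList.injective h2
    subst this; exact hc
  · intro h; exact ⟨k, v, rfl, h⟩

theorem key {n N : ℕ} (h : IHyp n N) (i : ℕ) (hi : 1 ≤ i) (hin : i ≤ n) (U : Mn n)
    {x y : FreeMonoid (Fin n)} (hr : ConGen.Rel (MnRel n) x y) :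
    ∀ a b, wt n (mkM n (a * x * b)) = N → (CW n i U (a * x * b) ↔ CW n i U (a * y * b)) := by
  have snd : ∀ {x y}, ConGen.Rel (MnRel n) x y → mkM n x = mkM n y :=
    fun h => PresentedMonoid.mk_eq_mk_iff.2 h
  induction hr with
  | of x y hxy =>
    intro a b hw
    have hs := snd (ConGen.Rel.of _ _ hxy)
    induction a using FreeMonoid.casesOn with
    | one =>
      obtain ⟨m, h1, h2⟩ := hxy
      simp only [one_mul, mul_assoc, CW_iff] at hw ⊢
      have en : n - 1 + 1 = n := by omega
      have em : m - 1 + 1 = m := by omega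
      simp only [mkM_mul, mkM_of, Nat.sub_self, Nat.zero_add, Nat.add_sub_cancel, en, em] at hw ⊢
      have hr := rho_rel n m h1 (by omega)
      have hw1 := hw
      rw [wt_mul, wt_rho _ _ (by omega) (by omega)] at hw1
      constructor
      · exact caseA h i m hi hin h1 (by omega) U _ (by omega)
      · refine caseB h i m hi hin h1 (by omega) U _ ?_
        simp only [wt_mul] at hw1 ⊢
        rw [wt_rho _ m (by omega) (by omega)] at hw1
        omega
    | of_mul k a =>
      simp only [mul_assoc, CW_iff]
      have : mkM n (a * (x * b)) = mkM n (a * (y * b)) := by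
        simp only [mkM, map_mul] at hs ⊢; rw [hs]
      rw [this]
  | refl x => intros; rfl
  | symm hxy ih =>
    intro a b hw
    refine (ih a b ?_).symm
    have hs := snd hxy
    rw [← hw]; simp only [mkM, map_mul] at hs ⊢; rw [hs]
  | trans h1 h2 ih1 ih2 =>
    intro a b hw
    refine (ih1 a b hw).trans (ih2 a b ?_)
    have hs := snd h1
    rw [← hw]; simp only [mkM, map_mul] at hs ⊢; rw [hs]
  | @mul w x y z h1 h2 ih1 ih2 =>
    intro a b hw
    have e1 := ih1 a (y * b) (by rw [← hw]; simp only [mul_assoc])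
    have hs := snd h1
    have e2 := ih2 (a * x) b (by
      rw [← hw]; simp only [mkM, map_mul] at hs ⊢; rw [hs]; simp only [mul_assoc])
    simp only [mul_assoc] at e1 e2 ⊢
    exact e1.trans e2

theorem ihyp (n N : ℕ) : IHyp n N := by
  induction N with
  | zero => intro i j U V _ _ _ _ _ hw; omega
  | succ N ih =>
    intro i j U V hi hin hj hjn e hw
    rcases Nat.lt_succ_iff_lt_or_eq.1 hw with hw | hw
    · exact ih i j U V hi hin hj hjn e hw
    obtain ⟨i, rfl⟩ : ∃ k, i = k + 1 := ⟨i - 1, by omega⟩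
    obtain ⟨j, rfl⟩ : ∃ k, j = k + 1 := ⟨j - 1, by omega⟩
    obtain ⟨u, rfl⟩ : ∃ u, mkM n u = U := PresentedMonoid.surjective_mk U
    obtain ⟨v, rfl⟩ : ∃ v, mkM n v = V := PresentedMonoid.surjective_mk V
    have e' : mkM n (FreeMonoid.of ⟨i, hin⟩ * u) = mkM n (FreeMonoid.of ⟨j, hjn⟩ * v) := by
      rw [← mkM_of n i hin, ← mkM_of n j hjn] at e
      simpa only [mkM, map_mul] using e
    have hr : ConGen.Rel (MnRel n) (FreeMonoid.of ⟨i, hin⟩ * u) (FreeMonoid.of ⟨j, hjn⟩ * v) :=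
      PresentedMonoid.mk_eq_mk_iff.1 e'
    have := key ih (i + 1) hi hin (mkM n u) hr 1 1 (by
      rw [← hw, ← mkM_of n i hin]; simp only [mkM, map_mul, one_mul, mul_one])
    simp only [one_mul, mul_one, CW_iff] at this
    exact this.1 (Or.inl ⟨rfl, rfl⟩)

/-- For `1 ≤ i < j ≤ n`, the element `ρ_i ρ_n^i ρ_{j-i} = ρ_j ρ_n^i` is the right-lcm of
`ρ_i` and `ρ_j` in `M_n`. -/
theorem stmt4 (n i j : ℕ) (hn : 1 ≤ n) (hi : 1 ≤ i) (hij : i < j) (hj : j ≤ n) :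
    rho n i * (rho n n) ^ i * rho n (j - i) = rho n j * (rho n n) ^ i ∧
    LDvd (rho n i) (rho n i * (rho n n) ^ i * rho n (j - i)) ∧
    LDvd (rho n j) (rho n i * (rho n n) ^ i * rho n (j - i)) ∧
    (∀ w : Mn n, LDvd (rho n i) w → LDvd (rho n j) w →
      LDvd (rho n i * (rho n n) ^ i * rho n (j - i)) w) := by
  have hid := rho_id n i hi j hij hj
  refine ⟨hid, ⟨_, (mul_assoc _ _ _).symm⟩, ⟨_, hid.symm⟩, ?_⟩
  rintro w ⟨U, rfl⟩ ⟨V, hV⟩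
  rcases ihyp n _ i j U V hi (by omega) (by omega) hj hV.symm (Nat.lt_succ_self _) with
    h | ⟨_, s, rfl, _⟩ | h
  · omega
  · exact ⟨s, by simp only [mul_assoc]⟩
  · omega
end

section
/- For every integer n ≥ 1, the monoid M_n is right-cancellative (for all a, b, c ∈ M_n, b·a = c·a implies b = c), and any two elements of M_n that admit a common left-multiple admit a left-lcm: if u, v ∈ M_n have a common left-multiple, then there exists m ∈ M_n such that u right-divides m, v right-divides m, and m right-divides every common left-multiple of u and v. -/
section Abstract

variable {M : Type*} [Monoid M]

/-- Left complement: `compl n r i j * r i` is the left-lcm of `r i` and `r j`. -/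
def lcompl (n : ℕ) (r : ℕ → M) (i j : ℕ) : M :=
  if i < j then (r 1 * r n) ^ (n - j + 1)
  else if j < i then r (j + (n - i) + 1) * (r 1 * r n) ^ (n - i) else 1

theorem lcompl_lt {n : ℕ} {r : ℕ → M} {i j : ℕ} (h : i < j) :
    lcompl n r i j = (r 1 * r n) ^ (n - j + 1) := by simp [lcompl, h]

theorem lcompl_gt {n : ℕ} {r : ℕ → M} {i j : ℕ} (h : j < i) :
    lcompl n r i j = r (j + (n - i) + 1) * (r 1 * r n) ^ (n - i) := by
  simp [lcompl, h, h.not_gt]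

theorem lcompl_self {n : ℕ} {r : ℕ → M} {i : ℕ} : lcompl n r i i = 1 := by simp [lcompl]

theorem derived {n : ℕ} {r : ℕ → M}
    (hrel : ∀ i, 1 ≤ i → i < n → r 1 * r n * r i = r (i + 1) * r n) (d : ℕ) :
    ∀ i j, 1 ≤ i → i < j → j + d = n →
      (r 1 * r n) ^ (d + 1) * r i = r (i + d + 1) * (r 1 * r n) ^ d * r j := by
  induction d with
  | zero =>
    intro i j h1 h2 h3
    have : j = n := by omega
    subst this
    simpa using hrel i h1 h2
  | succ d ih =>
    intro i j h1 h2 h3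
    have e := ih (i + 1) (j + 1) (by omega) (by omega) (by omega)
    have e1 := hrel i h1 (by omega)
    have e2 := hrel j (by omega) (by omega)
    calc (r 1 * r n) ^ (d + 1 + 1) * r i
        = (r 1 * r n) ^ (d + 1) * (r 1 * r n * r i) := by
          rw [pow_succ (r 1 * r n) (d + 1)]; simp only [mul_assoc]
      _ = (r 1 * r n) ^ (d + 1) * r (i + 1) * r n := by rw [e1]; simp only [mul_assoc]
      _ = r (i + 1 + d + 1) * (r 1 * r n) ^ d * (r (j + 1) * r n) := by
          rw [e]; simp only [mul_assoc]
      _ = r (i + (d + 1) + 1) * (r 1 * r n) ^ (d + 1) * r j := by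
          rw [← e2, show i + 1 + d + 1 = i + (d + 1) + 1 by omega, pow_succ]
          simp only [mul_assoc]

/-- Complements do give common multiples. -/
theorem lcompl_mul {n : ℕ} {r : ℕ → M}
    (hrel : ∀ i, 1 ≤ i → i < n → r 1 * r n * r i = r (i + 1) * r n)
    {i j : ℕ} (hi : 1 ≤ i) (hi' : i ≤ n) (hj : 1 ≤ j) (hj' : j ≤ n) :
    lcompl n r i j * r i = lcompl n r j i * r j := by
  rcases lt_trichotomy i j with h | h | h
  · rw [lcompl_lt h, lcompl_gt h]
    exact derived hrel (n - j) i j hi h (by omega)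
  · subst h; rfl
  · rw [lcompl_lt h, lcompl_gt h]
    exact (derived hrel (n - i) j i hj h (by omega)).symm

/-- The key property up to weight `N`. -/
def KL (n : ℕ) (r : ℕ → M) (wt : M → ℕ) (N : ℕ) : Prop :=
  ∀ u v s t, 1 ≤ s → s ≤ n → 1 ≤ t → t ≤ n → u * r s = v * r t → wt (u * r s) < N →
    ∃ w, u = w * lcompl n r s t ∧ v = w * lcompl n r t s

variable {n : ℕ} {r : ℕ → M} {wt : M → ℕ}

theorem KL.cancel {N : ℕ} (h : KL n r wt N) {u v : M} {s : ℕ} (hs : 1 ≤ s) (hs' : s ≤ n)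
    (e : u * r s = v * r s) (hw : wt (u * r s) < N) : u = v := by
  obtain ⟨w, h1, h2⟩ := h u v s s hs hs' hs hs' e hw
  rw [h1, h2]

theorem KL.cancel_pow {N : ℕ} (hwt : ∀ a b, wt (a * b) = wt a + wt b) (hn : 1 ≤ n)
    (h : KL n r wt N) (k : ℕ) : ∀ {u v : M},
    u * (r 1 * r n) ^ k = v * (r 1 * r n) ^ k → wt (u * (r 1 * r n) ^ k) < N → u = v := by
  induction k with
  | zero => intro u v e _; simpa using e
  | succ k ih =>
    intro u v e hw
    simp only [pow_succ, ← mul_assoc] at e hw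
    have e1 := h.cancel hn le_rfl e hw
    have hw1 := hw
    rw [hwt] at hw1
    have e2 := h.cancel le_rfl hn e1 (by omega)
    rw [hwt] at hw1
    exact ih e2 (by omega)

theorem cube_aux {N : ℕ} (hwt : ∀ a b, wt (a * b) = wt a + wt b) (hn : 1 ≤ n)
    (hrel : ∀ i, 1 ≤ i → i < n → r 1 * r n * r i = r (i + 1) * r n)
    (h : KL n r wt N) {w w' : M} {p s t : ℕ} (hp : 1 ≤ p) (hp' : p ≤ n)
    (hs : 1 ≤ s) (ht' : t ≤ n) (hst : s < t)
    (e : w * lcompl n r p s = w' * lcompl n r p t) (hw : wt (w * lcompl n r p s) < N) :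
    ∃ z, w * lcompl n r s p = z * lcompl n r s t ∧ w' * lcompl n r t p = z * lcompl n r t s := by
  rcases eq_or_ne p s with hps | hps
  · subst hps
    rw [lcompl_self, mul_one] at e ⊢
    exact ⟨w', e, rfl⟩
  rcases eq_or_ne p t with hpt | hpt
  · subst hpt
    rw [lcompl_self, mul_one] at e ⊢
    exact ⟨w, rfl, e.symm⟩
  rcases lt_or_gt_of_ne hps with hps | hps
  · -- p < s < t
    rw [lcompl_lt hps] at e hw
    rw [lcompl_lt (hps.trans hst)] at e
    have e0 : w * (r 1 * r n) ^ (t - s) = w' := by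
      refine h.cancel_pow hwt hn (n - t + 1) ?_ ?_
      · rw [mul_assoc, ← pow_add, ← e]; congr 2; omega
      · rw [mul_assoc, ← pow_add]
        rwa [show t - s + (n - t + 1) = n - s + 1 by omega]
    subst e0
    rw [lcompl_gt hps, lcompl_lt hst, lcompl_gt (hps.trans hst), lcompl_gt hst]
    refine ⟨w * r (p + (n - s) + 1) * (r 1 * r n) ^ (t - s - 1), ?_, ?_⟩
    · rw [mul_assoc _ _ ((r 1 * r n) ^ (n - t + 1)), ← pow_add,
        show t - s - 1 + (n - t + 1) = n - s by omega, mul_assoc]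
    · have d := derived hrel (t - s - 1) (p + (n - t) + 1) (s + (n - t) + 1)
        (by omega) (by omega) (by omega)
      rw [show t - s - 1 + 1 = t - s by omega,
        show p + (n - t) + 1 + (t - s - 1) + 1 = p + (n - s) + 1 by omega] at d
      calc _ = w * ((r 1 * r n) ^ (t - s) * r (p + (n - t) + 1)) * (r 1 * r n) ^ (n - t) := by
            simp only [mul_assoc]
        _ = _ := by rw [d]; simp only [mul_assoc]
  rcases lt_or_gt_of_ne hpt with hpt | hpt
  · -- s < p < t
    rw [lcompl_gt hps] at e hw
    rw [lcompl_lt hpt] at e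
    have e0 : w * r (s + (n - p) + 1) * (r 1 * r n) ^ (t - p - 1) = w' := by
      refine h.cancel_pow hwt hn (n - t + 1) ?_ ?_
      · rw [mul_assoc, ← pow_add, ← e, mul_assoc]; congr 3; omega
      · rw [mul_assoc, ← pow_add, mul_assoc]
        rwa [show t - p - 1 + (n - t + 1) = n - p by omega]
    subst e0
    rw [lcompl_lt hps, lcompl_lt hst, lcompl_gt hpt, lcompl_gt hst]
    refine ⟨w * (r 1 * r n) ^ (t - p), ?_, ?_⟩
    · rw [mul_assoc, ← pow_add]; congr 2; omega
    · have d := derived hrel (t - p - 1) (s + (n - t) + 1) (p + (n - t) + 1)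
        (by omega) (by omega) (by omega)
      rw [show t - p - 1 + 1 = t - p by omega,
        show s + (n - t) + 1 + (t - p - 1) + 1 = s + (n - p) + 1 by omega] at d
      symm
      calc _ = w * ((r 1 * r n) ^ (t - p) * r (s + (n - t) + 1)) * (r 1 * r n) ^ (n - t) := by
            simp only [mul_assoc]
        _ = _ := by rw [d]; simp only [mul_assoc]
  · -- s < t < p
    rw [lcompl_gt hps] at e hw
    rw [lcompl_gt hpt] at e
    simp only [← mul_assoc] at e hw
    have e0 := h.cancel_pow hwt hn _ e hw
    rw [hwt] at hw
    obtain ⟨z, h1, h2⟩ := h _ _ _ _ (by omega) (by omega) (by omega) (by omega) e0 (by omega)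
    rw [lcompl_lt (by omega)] at h1
    rw [lcompl_gt (by omega)] at h2
    refine ⟨z, ?_, ?_⟩
    · rw [h1, lcompl_lt hps, lcompl_lt hst, mul_assoc, ← pow_add]; congr 2; omega
    · rw [h2, lcompl_lt hpt, lcompl_gt hst]
      rw [mul_assoc, mul_assoc, ← pow_add,
        show s + (n - p) + 1 + (n - (t + (n - p) + 1)) + 1 = s + (n - t) + 1 by omega]
      congr 3; omega

theorem cube {N : ℕ} (hwt : ∀ a b, wt (a * b) = wt a + wt b) (hn : 1 ≤ n)
    (hrel : ∀ i, 1 ≤ i → i < n → r 1 * r n * r i = r (i + 1) * r n)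
    (h : KL n r wt N) {w w' : M} {p s t : ℕ} (hp : 1 ≤ p) (hp' : p ≤ n)
    (hs : 1 ≤ s) (hs' : s ≤ n) (ht : 1 ≤ t) (ht' : t ≤ n)
    (e : w * lcompl n r p s = w' * lcompl n r p t) (hw : wt (w * lcompl n r p s) < N) :
    ∃ z, w * lcompl n r s p = z * lcompl n r s t ∧ w' * lcompl n r t p = z * lcompl n r t s := by
  rcases lt_trichotomy s t with hst | hst | hst
  · exact cube_aux hwt hn hrel h hp hp' hs ht' hst e hw
  · subst hst
    have : w = w' := by
      rcases lt_trichotomy p s with hps | hps | hps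
      · rw [lcompl_lt hps] at e hw
        exact h.cancel_pow hwt hn _ e hw
      · subst hps; simpa [lcompl_self] using e
      · rw [lcompl_gt hps, ← mul_assoc] at hw
        rw [lcompl_gt hps, ← mul_assoc, ← mul_assoc] at e
        have e0 := h.cancel_pow hwt hn _ e hw
        rw [hwt] at hw
        exact h.cancel (by omega) (by omega) e0 (by omega)
    subst this
    exact ⟨w * lcompl n r s p, by simp [lcompl_self], by simp [lcompl_self]⟩
  · obtain ⟨z, h1, h2⟩ := cube_aux hwt hn hrel h hp hp' ht hs' hst e.symm (by rwa [← e])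
    exact ⟨z, h2, h1⟩

/-- Right cancellation by generators gives existence of lcms. -/
theorem lcm_exists (hwt : ∀ a b, wt (a * b) = wt a + wt b)
    (hr : ∀ i, 1 ≤ i → i ≤ n → wt (r i) = i)
    (hrel : ∀ i, 1 ≤ i → i < n → r 1 * r n * r i = r (i + 1) * r n)
    (hgen : ∀ u : M, u = 1 ∨ ∃ u' s, 1 ≤ s ∧ s ≤ n ∧ u = u' * r s)
    (hcan : ∀ a b c : M, b * a = c * a → b = c)
    (h : ∀ N, KL n r wt N) (N : ℕ) :
    ∀ a b u v : M, a * u = b * v → wt (a * u) < N →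
      ∃ m, RDvd u m ∧ RDvd v m ∧ ∀ w, RDvd u w → RDvd v w → RDvd m w := by
  induction N with
  | zero => intro a b u v _ h; omega
  | succ N ih =>
    intro a b u v e hw
    rcases hgen u with rfl | ⟨u', s, hs, hs', rfl⟩
    · exact ⟨v, ⟨v, mul_one v⟩, ⟨1, one_mul v⟩, fun w _ hv => hv⟩
    rcases hgen v with rfl | ⟨v', t, ht, ht', rfl⟩
    · exact ⟨u' * r s, ⟨1, one_mul _⟩, ⟨_, mul_one _⟩, fun w hv _ => hv⟩
    have key : ∀ A B : M, A * (u' * r s) = B * (v' * r t) →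
        ∃ c, A * u' = c * lcompl n r s t ∧ B * v' = c * lcompl n r t s := by
      intro A B e
      rw [← mul_assoc, ← mul_assoc] at e
      exact h _ _ _ _ _ hs hs' ht ht' e (Nat.lt_succ_self _)
    obtain ⟨c, h1, h2⟩ := key a b e
    have hw' := hw
    rw [e, ← mul_assoc, hwt, hr t ht ht'] at hw'
    rw [← mul_assoc, hwt, hr s hs hs'] at hw
    obtain ⟨m1, ⟨p, hp⟩, ⟨q, hq⟩, hm1⟩ := ih _ _ _ _ h1 (by omega)
    obtain ⟨m2, ⟨p', hp'⟩, ⟨q', hq'⟩, hm2⟩ := ih _ _ _ _ h2 (by omega)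
    have key2 : ∀ A B c : M, A * u' = c * lcompl n r s t → B * v' = c * lcompl n r t s →
        (∃ d, d * q = c) ∧ ∃ d', d' * q' = c := by
      intro A B c h1 h2
      obtain ⟨d, hd⟩ := hm1 (A * u') ⟨_, rfl⟩ ⟨_, h1.symm⟩
      obtain ⟨d', hd'⟩ := hm2 (B * v') ⟨_, rfl⟩ ⟨_, h2.symm⟩
      refine ⟨⟨d, hcan (lcompl n r s t) _ _ ?_⟩, ⟨d', hcan (lcompl n r t s) _ _ ?_⟩⟩
      · rw [← h1, ← hd, ← hq, mul_assoc]
      · rw [← h2, ← hd', ← hq', mul_assoc]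
    obtain ⟨⟨d, hd⟩, ⟨d', hd'⟩⟩ := key2 a b c h1 h2
    obtain ⟨m3, ⟨f, hf⟩, ⟨f', hf'⟩, hm3⟩ := ih d d' q q' (hd.trans hd'.symm) (by
      rw [hd]; rw [h1, hwt] at hw; omega)
    have hc := lcompl_mul hrel hs hs' ht ht'
    refine ⟨m3 * (lcompl n r s t * r s), ⟨f * p, ?_⟩, ⟨f' * p', ?_⟩, ?_⟩
    · rw [← hf, mul_assoc f q, ← mul_assoc q, hq, ← hp]; simp only [mul_assoc]
    · rw [hc, ← hf', mul_assoc f' q', ← mul_assoc q', hq', ← hp']; simp only [mul_assoc]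
    · rintro w ⟨A, rfl⟩ ⟨B, hB⟩
      obtain ⟨c, h1, h2⟩ := key A B hB.symm
      obtain ⟨hd, hd'⟩ := key2 A B c h1 h2
      obtain ⟨g, hg⟩ := hm3 c hd hd'
      exact ⟨g, by rw [← mul_assoc, hg, ← mul_assoc, ← h1, mul_assoc]⟩

end Abstract

theorem mk_surj (n : ℕ) (u : Mn n) : ∃ a, PresentedMonoid.mk (MnRel n) a = u :=
  Quotient.exists_rep u

/-- Weight on words. -/
def wtFree (n : ℕ) : FreeMonoid (Fin n) →* Multiplicative ℕ :=
  FreeMonoid.lift fun k => Multiplicative.ofAdd (k.val + 1)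

theorem wtFree_rel (n : ℕ) : ∀ a b, MnRel n a b → wtFree n a = wtFree n b := by
  rintro _ _ ⟨i, h1, h2⟩
  simp only [wtFree, map_mul, FreeMonoid.lift_eval_of, ← ofAdd_add]
  congr 1
  omega

/-- Weight on `Mn`. -/
def wtM (n : ℕ) (a : Mn n) : ℕ :=
  Multiplicative.toAdd (PresentedMonoid.lift (fun k : Fin n => Multiplicative.ofAdd (k.val + 1))
    (wtFree_rel n) a)

theorem wtM_mul (n : ℕ) (a b : Mn n) : wtM n (a * b) = wtM n a + wtM n b := by
  simp [wtM]

theorem wtM_of (n : ℕ) (k : Fin n) : wtM n (PresentedMonoid.of (MnRel n) k) = k.val + 1 := by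
  simp [wtM]

theorem rho_succ (n : ℕ) (k : Fin n) :
    rho n (k.val + 1) = PresentedMonoid.of (MnRel n) k := by
  have := k.isLt
  rw [rho, dif_pos (by omega)]
  congr 1

theorem wtM_rho (n i : ℕ) (h : 1 ≤ i) (h' : i ≤ n) : wtM n (rho n i) = i := by
  have := rho_succ n ⟨i - 1, by omega⟩
  simp only [Nat.sub_add_cancel h] at this
  rw [this, wtM_of]
  simp only
  omega

theorem rho_of (n i : ℕ) (h : 1 ≤ i) (h' : i ≤ n) :
    rho n i = PresentedMonoid.of (MnRel n) ⟨i - 1, by omega⟩ := by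
  rw [rho, dif_pos ⟨h, h'⟩]

theorem rho_rel_s5 (n i : ℕ) (h : 1 ≤ i) (h' : i < n) :
    rho n 1 * rho n n * rho n i = rho n (i + 1) * rho n n := by
  rw [rho_of n 1 le_rfl (by omega), rho_of n n (by omega) le_rfl, rho_of n i h h'.le,
    rho_of n (i + 1) (by omega) (by omega)]
  have := PresentedMonoid.mk_eq_mk_iff.2 (ConGen.Rel.of _ _ (MnRel.rel (n := n) i h (by omega)))
  exact this

theorem word_cases {α : Type*} (a : FreeMonoid α) :
    a = 1 ∨ ∃ u s, a = u * FreeMonoid.of s := by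
  rcases List.eq_nil_or_concat a.toList with h | ⟨L, b, h⟩
  · left; exact h
  · right; exact ⟨FreeMonoid.ofList L, b, FreeMonoid.toList.injective (by simpa using h)⟩

theorem word_inj {α : Type*} {u v : FreeMonoid α} {s t : α}
    (h : u * FreeMonoid.of s = v * FreeMonoid.of t) : u = v ∧ s = t := by
  have h' : u.toList ++ [s] = v.toList ++ [t] := h
  have := List.append_inj' h' rfl
  exact ⟨this.1, by simpa using this.2⟩

theorem mn_gen (n : ℕ) (u : Mn n) : u = 1 ∨ ∃ u' s, 1 ≤ s ∧ s ≤ n ∧ u = u' * rho n s := by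
  obtain ⟨a, rfl⟩ := mk_surj n u
  rcases word_cases a with rfl | ⟨a', s, rfl⟩
  · left; exact map_one _
  · right
    refine ⟨PresentedMonoid.mk _ a', s.val + 1, by omega, by omega, ?_⟩
    rw [rho_succ]; rfl

theorem mk_mul_of (n : ℕ) (u : FreeMonoid (Fin n)) (s : Fin n) :
    PresentedMonoid.mk (MnRel n) (u * FreeMonoid.of s) =
      PresentedMonoid.mk (MnRel n) u * rho n (s.val + 1) := by
  rw [rho_succ]; rfl

/-- Equivalent words: last letters are related through complements. -/
theorem word_key (n : ℕ) (hn : 1 ≤ n) {a b : FreeMonoid (Fin n)} (h : ConGen.Rel (MnRel n) a b) :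
    KL n (rho n) (wtM n) (wtM n (PresentedMonoid.mk _ a)) →
    ((a = 1 ↔ b = 1) ∧ ∀ u v s t, a = u * FreeMonoid.of s → b = v * FreeMonoid.of t →
      ∃ w, PresentedMonoid.mk _ u = w * lcompl n (rho n) (s.val + 1) (t.val + 1) ∧
        PresentedMonoid.mk _ v = w * lcompl n (rho n) (t.val + 1) (s.val + 1)) := by
  induction h with
  | of a b h =>
    intro _
    obtain ⟨i, h1, h2⟩ := h
    refine ⟨⟨fun h => ?_, fun h => ?_⟩, ?_⟩
    · exact absurd (congrArg FreeMonoid.length h) (by simp [FreeMonoid.length_mul])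
    · exact absurd (congrArg FreeMonoid.length h) (by simp [FreeMonoid.length_mul])
    intro u v s t ha hb
    obtain ⟨rfl, rfl⟩ := word_inj ha
    obtain ⟨rfl, rfl⟩ := word_inj hb
    refine ⟨1, ?_, ?_⟩
    · rw [lcompl_lt (by simp only; omega)]
      simp only [one_mul]
      rw [show n - (n - 1 + 1) + 1 = 1 by omega, pow_one, rho_of n 1 le_rfl hn,
        rho_of n n hn le_rfl]
      rfl
    · rw [lcompl_gt (by simp only; omega)]
      simp only [one_mul]
      rw [show n - (n - 1 + 1) = 0 by omega, pow_zero, mul_one,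
        show i - 1 + 1 + 0 + 1 = i + 1 by omega, rho_of n (i + 1) (by omega) (by omega)]
      rfl
  | refl a =>
    intro _
    refine ⟨Iff.rfl, ?_⟩
    intro u v s t ha hb
    obtain ⟨rfl, rfl⟩ := word_inj (ha.symm.trans hb)
    exact ⟨PresentedMonoid.mk _ u, by simp [lcompl_self], by simp [lcompl_self]⟩
  | symm h ih =>
    intro hK
    have e := PresentedMonoid.mk_eq_mk_iff.2 h
    rw [← e] at hK
    obtain ⟨h1, h2⟩ := ih hK
    refine ⟨h1.symm, fun u v s t ha hb => ?_⟩
    obtain ⟨w, hw⟩ := h2 v u t s hb ha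
    exact ⟨w, hw.2, hw.1⟩
  | @trans x y z h h' ih ih' =>
    intro hK
    have e := PresentedMonoid.mk_eq_mk_iff.2 h
    obtain ⟨h1, h2⟩ := ih hK
    obtain ⟨h1', h2'⟩ := ih' (by rwa [← e])
    refine ⟨h1.trans h1', fun u v s t ha hb => ?_⟩
    rcases word_cases y with hy | ⟨y', p, hy⟩
    · exfalso
      have := h1.2 hy
      rw [this] at ha
      exact absurd (congrArg FreeMonoid.length ha) (by simp [FreeMonoid.length_mul])
    obtain ⟨w, e1, e2⟩ := h2 u y' s p ha hy
    obtain ⟨w', e1', e2'⟩ := h2' y' v p t hy hb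
    rw [e1, e2']
    refine cube (wtM_mul n) hn (rho_rel_s5 n) hK (by omega) (by omega) (by omega) (by omega)
      (by omega) (by omega) (e2.symm.trans e1') ?_
    rw [← e2, e, hy, mk_mul_of, wtM_mul, wtM_rho _ _ (by omega) (by omega)]
    omega
  | @mul w x y z h h' ih ih' =>
    intro hK
    have e := PresentedMonoid.mk_eq_mk_iff.2 h
    rw [map_mul, wtM_mul] at hK
    obtain ⟨h1, h2⟩ := ih (fun u v s t a b c d e f => hK u v s t a b c d e (by omega))
    obtain ⟨h1', h2'⟩ := ih' (fun u v s t a b c d e f => hK u v s t a b c d e (by omega))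
    rcases word_cases y with hy | ⟨y', s', hy⟩
    · have hz := h1'.1 hy
      subst hy hz
      simp only [mul_one]
      exact ⟨h1, h2⟩
    rcases word_cases z with hz | ⟨z', t', hz⟩
    · have hy' := h1'.2 hz
      subst hy' hz
      simp only [mul_one]
      exact ⟨h1, h2⟩
    refine ⟨⟨fun h => ?_, fun h => ?_⟩, ?_⟩
    · rw [hy] at h
      exact absurd (congrArg FreeMonoid.length h) (by simp [FreeMonoid.length_mul])
    · rw [hz] at h
      exact absurd (congrArg FreeMonoid.length h) (by simp [FreeMonoid.length_mul])
    intro u v s t ha hb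
    rw [hy, ← mul_assoc] at ha
    rw [hz, ← mul_assoc] at hb
    obtain ⟨rfl, rfl⟩ := word_inj ha
    obtain ⟨rfl, rfl⟩ := word_inj hb
    obtain ⟨c, e1, e2⟩ := h2' y' z' _ _ hy hz
    refine ⟨PresentedMonoid.mk _ w * c, ?_, ?_⟩
    · rw [map_mul, e1, mul_assoc]
    · rw [map_mul, e2, e, mul_assoc]

theorem mn_KL (n : ℕ) (hn : 1 ≤ n) (N : ℕ) : KL n (rho n) (wtM n) N := by
  induction N with
  | zero => intro u v s t _ _ _ _ _ h; omega
  | succ N ih =>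
    intro u v s t hs hs' ht ht' e hw
    obtain ⟨a, rfl⟩ := mk_surj n u
    obtain ⟨b, rfl⟩ := mk_surj n v
    obtain ⟨s, rfl⟩ : ∃ k, s = k + 1 := ⟨s - 1, by omega⟩
    obtain ⟨t, rfl⟩ : ∃ k, t = k + 1 := ⟨t - 1, by omega⟩
    have e1 := mk_mul_of n a ⟨s, by omega⟩
    have e2 := mk_mul_of n b ⟨t, by omega⟩
    simp only at e1 e2
    rw [← e1] at hw e
    rw [← e2] at e
    have hrel : ConGen.Rel (MnRel n) _ _ := Quotient.exact e
    refine (word_key n hn hrel ?_).2 _ _ _ _ rfl rfl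
    intro u v s t a b c d e f
    exact ih u v s t a b c d e (by omega)

theorem mn_cancel (n : ℕ) (hn : 1 ≤ n) (a b c : Mn n) (h : b * a = c * a) : b = c := by
  obtain ⟨a, rfl⟩ := mk_surj n a
  induction a using FreeMonoid.inductionOn' generalizing b c with
  | one => simpa using h
  | of_mul k a ih =>
    rw [map_mul, ← mul_assoc, ← mul_assoc] at h
    have h := ih _ _ h
    have e : PresentedMonoid.mk (MnRel n) (FreeMonoid.of k) = rho n (k.val + 1) := by
      rw [rho_succ]; rfl
    rw [e] at h
    exact (mn_KL n hn _).cancel (by omega) (by omega) h (Nat.lt_succ_self _)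

/-- `M_n` is right-cancellative and admits conditional left-lcms. -/
theorem stmt5 (n : ℕ) (hn : 1 ≤ n) :
    (∀ a b c : Mn n, b * a = c * a → b = c) ∧
    (∀ u v : Mn n, (∃ w, RDvd u w ∧ RDvd v w) →
      ∃ m, RDvd u m ∧ RDvd v m ∧ ∀ w, RDvd u w → RDvd v w → RDvd m w) := by
  refine ⟨mn_cancel n hn, ?_⟩
  rintro u v ⟨w, ⟨a, ha⟩, ⟨b, hb⟩⟩
  exact lcm_exists (wtM_mul n) (wtM_rho n) (rho_rel_s5 n) (mn_gen n) (mn_cancel n hn) (mn_KL n hn) _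
    a b u v (ha.trans hb.symm) (Nat.lt_succ_self _)
end

section
/- For every integer n ≥ 1, any two elements u, v of the monoid M_n admit a right-lcm and a left-lcm: there exists m ∈ M_n left-divided by both u and v and left-dividing every common right-multiple of u and v, and there exists m' ∈ M_n right-divided by both u and v and right-dividing every common left-multiple of u and v. -/
namespace MnAux

variable {n : ℕ}

def o (k : Fin n) : Mn n := PresentedMonoid.of (MnRel n) k

def q (x : FreeMonoid (Fin n)) : Mn n := PresentedMonoid.mk (MnRel n) x

theorem q_mul (x y : FreeMonoid (Fin n)) : q (x * y) = q x * q y := rfl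
theorem q_one : q (1 : FreeMonoid (Fin n)) = 1 := rfl
theorem q_of (k : Fin n) : q (FreeMonoid.of k) = o k := rfl

theorem q_surj (u : Mn n) : ∃ x, q x = u := PresentedMonoid.surjective_mk u

theorem q_eq {x y : FreeMonoid (Fin n)} : q x = q y ↔ ConGen.Rel (MnRel n) x y :=
  Con.eq (conGen (MnRel n))

/-- the basic relation -/
theorem basic (z l i j : Fin n) (hz : z.val = 0) (hl : l.val = n - 1) (hij : j.val = i.val + 1) :
    o z * o l * o i = o j * o l := by
  have h := q_eq.2 (ConGen.Rel.of _ _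
    (MnRel.rel (n := n) (i.val + 1) (by omega) (by have := j.2; omega)))
  have e1 : z = ⟨1 - 1, by have := z.2; omega⟩ := Fin.ext (by simp [hz])
  have e2 : l = ⟨n - 1, by have := z.2; omega⟩ := Fin.ext (by simp [hl])
  have e3 : j = ⟨i.val + 1 + 1 - 1, by have := j.2; omega⟩ := Fin.ext (by simp [hij])
  rw [e1, e2, e3]
  exact h

def wt : Mn n →* Multiplicative ℕ :=
  PresentedMonoid.lift (fun k : Fin n => Multiplicative.ofAdd (k.val + 1)) (by
    rintro a b ⟨i, h1, h2⟩
    simp only [map_mul, FreeMonoid.lift_eval_of, ← ofAdd_add]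
    congr 1
    omega)

def w (u : Mn n) : ℕ := Multiplicative.toAdd (wt u)

theorem w_mul (u v : Mn n) : w (u * v) = w u + w v := by simp [w]
theorem w_one : w (1 : Mn n) = 0 := by simp [w]
theorem w_o (k : Fin n) : w (o k) = k.val + 1 := by
  simp [w, wt, o]

theorem ind {C : Mn n → Prop} (h1 : C 1) (h2 : ∀ a u, C u → C (o a * u)) (u : Mn n) : C u := by
  obtain ⟨x, rfl⟩ := q_surj u
  induction x using FreeMonoid.recOn with
  | one => exact h1
  | of_mul a x ih => exact h2 a _ ih

theorem cases1 (u : Mn n) : u = 1 ∨ ∃ a v, u = o a * v :=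
  ind (C := fun u => u = 1 ∨ ∃ a v, u = o a * v) (Or.inl rfl)
    (fun a u _ => Or.inr ⟨a, u, rfl⟩) u

theorem w_zero {u : Mn n} (h : w u = 0) : u = 1 := by
  rcases cases1 u with h' | ⟨a, v, rfl⟩
  · exact h'
  · rw [w_mul, w_o] at h; omega

/-- `c` is such that `ρ_k u = ρ_1 c` by pulling to the front. -/
def P (k : Fin n) (u c : Mn n) : Prop :=
  (k.val = 0 ∧ c = u) ∨
    ∃ (l j : Fin n) (t : Mn n), l.val = n - 1 ∧ k.val = j.val + 1 ∧ u = o l * t ∧ c = o l * (o j * t)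

def K (a : Fin n) (u : Mn n) (b : Fin n) (v : Mn n) : Prop :=
  (a = b ∧ u = v) ∨ ∃ c, P a u c ∧ P b v c

theorem P_mul {k : Fin n} {u c : Mn n} (h : P k u c) (z : Mn n) : P k (u * z) (c * z) := by
  rcases h with ⟨h, rfl⟩ | ⟨l, j, t, h1, h2, rfl, rfl⟩
  · exact Or.inl ⟨h, rfl⟩
  · exact Or.inr ⟨l, j, t * z, h1, h2, by simp only [mul_assoc], by simp only [mul_assoc]⟩

theorem K_mul {a b : Fin n} {u v : Mn n} (h : K a u b v) (z : Mn n) : K a (u * z) b (v * z) := by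
  rcases h with ⟨h, rfl⟩ | ⟨c, h1, h2⟩
  · exact Or.inl ⟨h, rfl⟩
  · exact Or.inr ⟨c * z, P_mul h1 z, P_mul h2 z⟩

theorem K_symm {a b : Fin n} {u v : Mn n} (h : K a u b v) : K b v a u := by
  rcases h with ⟨h, h'⟩ | ⟨c, h1, h2⟩
  · exact Or.inl ⟨h.symm, h'.symm⟩
  · exact Or.inr ⟨c, h2, h1⟩

def LC (n N : ℕ) : Prop :=
  ∀ (a : Fin n) (u v : Mn n), w (o a * u) < N → o a * u = o a * v → u = v

theorem P_unique {N : ℕ} (ih : LC n N) {k : Fin n} {u c d : Mn n} (hu : w (o k * u) ≤ N)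
    (h : P k u c) (h' : P k u d) : c = d := by
  rcases h with ⟨h, rfl⟩ | ⟨l, j, t, h1, h2, rfl, rfl⟩
  · rcases h' with ⟨h', rfl⟩ | ⟨l, j, t, h1, h2, rfl, rfl⟩
    · rfl
    · omega
  · rcases h' with ⟨h', rfl⟩ | ⟨l', j', t', h1', h2', h3, rfl⟩
    · omega
    · obtain rfl : l = l' := Fin.ext (by omega)
      obtain rfl : j = j' := Fin.ext (by omega)
      have : t = t' := ih l t t' (by rw [w_mul, w_o] at hu; omega) h3
      rw [this]

theorem K_trans {N : ℕ} (ih : LC n N) {a b d : Fin n} {u v x : Mn n} (hu : w (o b * v) ≤ N)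
    (h : K a u b v) (h' : K b v d x) : K a u d x := by
  rcases h with ⟨rfl, rfl⟩ | ⟨c, h1, h2⟩
  · exact h'
  · rcases h' with ⟨rfl, rfl⟩ | ⟨c', h1', h2'⟩
    · exact Or.inr ⟨c, h1, h2⟩
    · have := P_unique ih hu h2 h1'
      subst this
      exact Or.inr ⟨c, h1, h2'⟩

def Q (x y : FreeMonoid (Fin n)) : Prop :=
  (x = 1 ∧ y = 1) ∨ ∃ a u b v, x = FreeMonoid.of a * u ∧ y = FreeMonoid.of b * v ∧
    K a (q u) b (q v)

theorem cons_inj {a b : Fin n} {u v : FreeMonoid (Fin n)}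
    (h : FreeMonoid.of a * u = FreeMonoid.of b * v) : a = b ∧ u = v := by
  have h' : (a :: FreeMonoid.toList u) = b :: FreeMonoid.toList v := by
    have := congrArg FreeMonoid.toList h
    simpa using this
  exact ⟨(List.cons.inj h').1, (List.cons.inj h').2⟩

theorem cons_ne {a : Fin n} {u : FreeMonoid (Fin n)} (h : FreeMonoid.of a * u = 1) : False := by
  have := congrArg FreeMonoid.toList h
  simp at this

theorem chain {N : ℕ} (ih : LC n N) {x y : FreeMonoid (Fin n)} (h : ConGen.Rel (MnRel n) x y) :
    w (q x) ≤ N → Q x y := by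
  induction h with
  | of x y h =>
    intro _
    obtain ⟨i, h1, h2⟩ := h
    refine Or.inr ⟨_, _, _, _, mul_assoc _ _ _, rfl, Or.inr ⟨_, Or.inl ⟨rfl, rfl⟩, ?_⟩⟩
    refine Or.inr ⟨⟨n - 1, by omega⟩, ⟨i - 1, by omega⟩, 1, rfl, ?_, ?_, ?_⟩
    · simp; omega
    · rw [mul_one]; rfl
    · rw [mul_one]; rfl
  | refl x =>
    intro _
    cases x using FreeMonoid.casesOn with
    | one => exact Or.inl ⟨rfl, rfl⟩
    | of_mul a u => exact Or.inr ⟨a, u, a, u, rfl, rfl, Or.inl ⟨rfl, rfl⟩⟩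
  | symm h ih' =>
    intro hw
    rw [← q_eq.2 h] at hw
    rcases ih' hw with ⟨h1, h2⟩ | ⟨a, u, b, v, h1, h2, h3⟩
    · exact Or.inl ⟨h2, h1⟩
    · exact Or.inr ⟨b, v, a, u, h2, h1, K_symm h3⟩
  | trans h h' ih1 ih2 =>
    intro hw
    have hw' := hw
    rw [q_eq.2 h] at hw'
    rcases ih1 hw with ⟨h1, h2⟩ | ⟨a, u, b, v, h1, h2, h3⟩
    · rcases ih2 hw' with ⟨h1', h2'⟩ | ⟨a, u, b, v, h1', h2', h3'⟩
      · exact Or.inl ⟨h1, h2'⟩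
      · exact (cons_ne (h1'.symm.trans h2)).elim
    · rcases ih2 hw' with ⟨h1', h2'⟩ | ⟨a', u', b', v', h1', h2', h3'⟩
      · exact (cons_ne (h2.symm.trans h1')).elim
      · obtain ⟨rfl, rfl⟩ := cons_inj (h2.symm.trans h1')
        refine Or.inr ⟨a, u, b', v', h1, h2', K_trans ih ?_ h3 h3'⟩
        rw [h2, q_mul, q_of] at hw'
        exact hw'
  | mul h h' ih1 ih2 =>
    intro hw
    rw [q_mul, w_mul] at hw
    rcases ih1 (by omega) with ⟨h1, h2⟩ | ⟨a, u, b, v, h1, h2, h3⟩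
    · rw [h1, h2, one_mul, one_mul]
      exact ih2 (by omega)
    · refine Or.inr ⟨a, u * _, b, v * _, by rw [h1, mul_assoc], by rw [h2, mul_assoc], ?_⟩
      rw [q_mul, q_mul, q_eq.2 h']
      exact K_mul h3 _

theorem key_of {N : ℕ} (ih : LC n N) {a b : Fin n} {u v : Mn n} (hw : w (o a * u) ≤ N)
    (h : o a * u = o b * v) : K a u b v := by
  obtain ⟨x, rfl⟩ := q_surj u
  obtain ⟨y, rfl⟩ := q_surj v
  have h' : q (FreeMonoid.of a * x) = q (FreeMonoid.of b * y) := h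
  rcases chain ih (q_eq.1 h') hw with ⟨h1, h2⟩ | ⟨a', u, b', v, h1, h2, h3⟩
  · exact (cons_ne h1).elim
  · obtain ⟨rfl, rfl⟩ := cons_inj h1
    obtain ⟨rfl, rfl⟩ := cons_inj h2
    exact h3

theorem lc (N : ℕ) : LC n N := by
  induction N with
  | zero => intro a u v h; omega
  | succ N ih =>
    intro a u v hw h
    rcases key_of ih (by omega) h with ⟨_, h'⟩ | ⟨c, h1, h2⟩
    · exact h'
    · rw [w_mul, w_o] at hw
      rcases h1 with ⟨h1, rfl⟩ | ⟨l, j, t, h1, h3, rfl, rfl⟩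
      · rcases h2 with ⟨h2, rfl⟩ | ⟨l, j, t, h2, h3, rfl, rfl⟩
        · rfl
        · omega
      · rcases h2 with ⟨h2, rfl⟩ | ⟨l', j', t', h2, h4, rfl, h5⟩
        · omega
        · obtain rfl : l = l' := Fin.ext (by omega)
          obtain rfl : j = j' := Fin.ext (by omega)
          simp only [w_mul, w_o] at hw
          have h6 := ih l _ _ (by simp only [w_mul, w_o]; omega) h5
          have h7 := ih j _ _ (by simp only [w_mul, w_o]; omega) h6
          rw [h7]

theorem lcancel_o {a : Fin n} {u v : Mn n} (h : o a * u = o a * v) : u = v :=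
  lc _ a u v (Nat.lt_succ_self _) h

theorem key {a b : Fin n} {u v : Mn n} (h : o a * u = o b * v) : K a u b v :=
  key_of (lc _) le_rfl h

theorem lcancel (s : Mn n) : ∀ {u v : Mn n}, s * u = s * v → u = v := by
  refine ind (C := fun s => ∀ {u v : Mn n}, s * u = s * v → u = v) ?_ ?_ s
  · intro u v h; simpa using h
  · intro a s ih u v h
    rw [mul_assoc, mul_assoc] at h
    exact ih (lcancel_o h)

def IsLcm (u v m : Mn n) : Prop := LDvd u m ∧ LDvd v m ∧ ∀ x, LDvd u x → LDvd v x → LDvd m x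

theorem IsLcm.symm {u v m : Mn n} (h : IsLcm u v m) : IsLcm v u m :=
  ⟨h.2.1, h.1, fun x h1 h2 => h.2.2 x h2 h1⟩

theorem LDvd.trans' {u v x : Mn n} (h : LDvd u v) (h' : LDvd v x) : LDvd u x := by
  obtain ⟨a, rfl⟩ := h
  obtain ⟨b, rfl⟩ := h'
  exact ⟨a * b, by rw [mul_assoc]⟩

theorem ldvd_mul (s : Mn n) {u v : Mn n} (h : LDvd u v) : LDvd (s * u) (s * v) := by
  obtain ⟨a, rfl⟩ := h
  exact ⟨a, by rw [mul_assoc]⟩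

theorem ldvd_of_mul (s : Mn n) {u v : Mn n} (h : LDvd (s * u) (s * v)) : LDvd u v := by
  obtain ⟨a, h⟩ := h
  rw [mul_assoc] at h
  exact ⟨a, lcancel s h⟩

theorem IsLcm.lmul (s : Mn n) {u v m : Mn n} (h : IsLcm u v m) : IsLcm (s * u) (s * v) (s * m) := by
  refine ⟨ldvd_mul s h.1, ldvd_mul s h.2.1, ?_⟩
  rintro x ⟨a, rfl⟩ h2
  rw [mul_assoc] at h2 ⊢
  exact ldvd_mul s (h.2.2 _ ⟨a, rfl⟩ (ldvd_of_mul s h2))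

/-- atoms have lcms -/
theorem atom_lcm_lt (N : ℕ) : ∀ a b : Fin n, a.val < b.val → b.val ≤ N →
    ∃ m, IsLcm (o a) (o b) m := by
  induction N with
  | zero => intro a b h h'; omega
  | succ N ih =>
    intro a b hab hb
    have hb2 := b.2
    obtain ⟨l, hl⟩ : ∃ l : Fin n, l.val = n - 1 := ⟨⟨n - 1, by omega⟩, rfl⟩
    obtain ⟨z, hz⟩ : ∃ z : Fin n, z.val = 0 := ⟨⟨0, by omega⟩, rfl⟩
    obtain ⟨b', hb'⟩ : ∃ c : Fin n, b.val = c.val + 1 :=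
      ⟨⟨b.val - 1, by omega⟩, by simp only; omega⟩
    have rb := basic z l b' b hz hl hb'
    by_cases ha : a.val = 0
    · obtain rfl : a = z := Fin.ext (by omega)
      refine ⟨o b * o l, ⟨o l * o b', by rw [← rb, mul_assoc]⟩, ⟨o l, rfl⟩, ?_⟩
      rintro x ⟨u, rfl⟩ ⟨v, hv⟩
      rcases key hv with ⟨h, _⟩ | ⟨c, h1, h2⟩
      · subst h; omega
      · rcases h1 with ⟨h1, _⟩ | ⟨l', j, t, h1, h3, rfl, rfl⟩
        · omega
        · obtain rfl : l = l' := Fin.ext (by omega)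
          exact ⟨t, by rw [← hv, mul_assoc]⟩
    · obtain ⟨a', ha'⟩ : ∃ c : Fin n, a.val = c.val + 1 :=
        ⟨⟨a.val - 1, by omega⟩, by simp only; omega⟩
      have ra := basic z l a' a hz hl ha'
      obtain ⟨m, hm⟩ := ih a' b' (by omega) (by omega)
      obtain ⟨h1, h2, h3⟩ := hm.lmul (o z * o l)
      rw [ra] at h1 h3
      rw [rb] at h2 h3
      refine ⟨o z * o l * m, LDvd.trans' ⟨o l, rfl⟩ h1, LDvd.trans' ⟨o l, rfl⟩ h2, ?_⟩
      rintro x ⟨u, rfl⟩ ⟨v, hv⟩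
      rcases key hv with ⟨h, _⟩ | ⟨c, h4, h5⟩
      · subst h; omega
      · rcases h4 with ⟨h4, _⟩ | ⟨l', j, t, h4, h6, rfl, rfl⟩
        · omega
        · rcases h5 with ⟨h5, _⟩ | ⟨l'', j', t', h5, h7, rfl, _⟩
          · omega
          · obtain rfl : l = l' := Fin.ext (by omega)
            obtain rfl : l = l'' := Fin.ext (by omega)
            exact h3 _ ⟨t', by rw [mul_assoc]⟩ ⟨t, by rw [← hv, mul_assoc]⟩

theorem ldvd_refl (u : Mn n) : LDvd u u := ⟨1, mul_one u⟩
theorem one_ldvd (u : Mn n) : LDvd 1 u := ⟨u, one_mul u⟩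

theorem atom_lcm (a b : Fin n) : ∃ m, IsLcm (o a) (o b) m := by
  rcases lt_trichotomy a.val b.val with h | h | h
  · exact atom_lcm_lt _ a b h le_rfl
  · obtain rfl : a = b := Fin.ext h
    exact ⟨o a, ldvd_refl _, ldvd_refl _, fun x h _ => h⟩
  · obtain ⟨m, hm⟩ := atom_lcm_lt _ b a h le_rfl
    exact ⟨m, hm.symm⟩

theorem lcm_of_common (N : ℕ) : ∀ (x u v : Mn n), w x < N → LDvd u x → LDvd v x →
    ∃ m, IsLcm u v m := by
  induction N with
  | zero => intro x u v h; omega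
  | succ N ih =>
    intro x u v hx hu hv
    rcases cases1 u with rfl | ⟨a, u, rfl⟩
    · exact ⟨v, one_ldvd _, ldvd_refl _, fun x _ h => h⟩
    rcases cases1 v with rfl | ⟨b, v, rfl⟩
    · exact ⟨o a * u, ldvd_refl _, one_ldvd _, fun x h _ => h⟩
    obtain ⟨m, ⟨a', ha⟩, ⟨b', hb⟩, hm⟩ := atom_lcm a b
    have hxa : LDvd (o a) x := LDvd.trans' ⟨u, rfl⟩ hu
    have hxb : LDvd (o b) x := LDvd.trans' ⟨v, rfl⟩ hv
    have hxm := hm x hxa hxb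
    obtain ⟨xa, rfl⟩ := hxa
    obtain ⟨xb, hxb⟩ := hxb
    have hxw : w xb < N := by
      rw [← hxb, w_mul, w_o] at hx; omega
    rw [w_mul, w_o] at hx
    rw [← ha] at hxm
    obtain ⟨p, hp⟩ := ih xa u a' (by omega) (ldvd_of_mul _ hu) (ldvd_of_mul _ hxm)
    have hap := hp.lmul (o a)
    rw [ha] at hap
    have hbq : LDvd (o b) (o a * p) := LDvd.trans' ⟨b', hb⟩ hap.2.1
    have hapx : LDvd (o a * p) (o a * xa) := hap.2.2 _ hu (ha ▸ hxm)
    obtain ⟨r, hr⟩ := hbq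
    rw [← hxb] at hv
    rw [← hxb, ← hr] at hapx
    obtain ⟨s, hs⟩ := ih xb r v hxw (ldvd_of_mul _ hapx) (ldvd_of_mul _ hv)
    have hbs := hs.lmul (o b)
    rw [hr] at hbs
    refine ⟨o b * s, LDvd.trans' hap.1 hbs.1, hbs.2.1, ?_⟩
    intro y h1 h2
    refine hbs.2.2 y (hap.2.2 y h1 (hm y (LDvd.trans' ⟨u, rfl⟩ h1) (LDvd.trans' ⟨v, rfl⟩ h2))) h2

theorem pow_left (z l : Fin n) (hz : z.val = 0) (hl : l.val = n - 1)
    (k : ℕ) : ∀ i j : Fin n, j.val = i.val + k →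
    (o z * o l) ^ k * o i = o j * o l ^ k := by
  induction k with
  | zero => intro i j h; obtain rfl : i = j := Fin.ext (by omega); simp
  | succ k ih =>
    intro i j h
    have hj := j.2
    obtain ⟨i', hi⟩ : ∃ c : Fin n, c.val = i.val + 1 := ⟨⟨i.val + 1, by omega⟩, rfl⟩
    rw [pow_succ, mul_assoc, basic z l i i' hz hl hi, ← mul_assoc, ih i' j (by omega), mul_assoc,
      ← pow_succ]

theorem pow_eq (z l : Fin n) (hz : z.val = 0) (hl : l.val = n - 1)
    (j : Fin n) : (o z * o l) ^ (j.val + 1) = o j * o l ^ (j.val + 1) := by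
  rw [pow_succ, ← mul_assoc, pow_left z l hz hl j.val z j (by omega), mul_assoc, ← pow_succ]

theorem delta_eq (z l : Fin n) (hz : z.val = 0) (hl : l.val = n - 1)
    : (o z * o l) ^ n = o l ^ (n + 1) := by
  have h := pow_eq z l hz hl l
  have : l.val + 1 = n := by have := z.2; omega
  rw [this] at h
  rw [h, ← pow_succ']

theorem delta_comm (z l : Fin n) (hz : z.val = 0) (hl : l.val = n - 1)
    (u : Mn n) : Commute (o l ^ (n + 1)) u := by
  refine ind (C := fun u => Commute (o l ^ (n + 1)) u) (Commute.one_right _) ?_ u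
  intro i u hu
  refine Commute.mul_right ?_ hu
  have hx : Commute (o l ^ (n + 1)) ((o z * o l) ^ (n - 1 - i.val)) := by
    rw [← delta_eq z l hz hl]
    exact Commute.pow_pow_self _ _ _
  have h := pow_left z l hz hl (n - 1 - i.val) i l (by have := i.2; omega)
  apply lcancel ((o z * o l) ^ (n - 1 - i.val))
  have hy : Commute (o l ^ (n + 1)) (o l * o l ^ (n - 1 - i.val)) := by
    rw [← pow_succ']
    exact Commute.pow_pow_self _ _ _
  rw [← h] at hy
  rw [← mul_assoc, ← hx.eq, mul_assoc, hy.eq, mul_assoc]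

theorem dvd_delta (z l : Fin n) (hz : z.val = 0) (hl : l.val = n - 1)
    (u : Mn n) : ∃ k s, u * s = (o l ^ (n + 1)) ^ k := by
  refine ind (C := fun u => ∃ k s, u * s = (o l ^ (n + 1)) ^ k) ⟨0, 1, by simp⟩ ?_ u
  rintro a u ⟨k, s, h⟩
  refine ⟨k + 1, s * (o l ^ (a.val + 1) * (o z * o l) ^ (n - 1 - a.val)), ?_⟩
  have h2 : o a * (o l ^ (a.val + 1) * (o z * o l) ^ (n - 1 - a.val)) = o l ^ (n + 1) := by
    rw [← mul_assoc, ← pow_eq z l hz hl a, ← pow_add, ← delta_eq z l hz hl]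
    congr 1
    have := a.2
    omega
  have hc : Commute ((o l ^ (n + 1)) ^ k) (o a) := (delta_comm z l hz hl (o a)).pow_left k
  calc _ = o a * (u * s) * (o l ^ (a.val + 1) * (o z * o l) ^ (n - 1 - a.val)) := by
        simp only [mul_assoc]
    _ = _ := by rw [h, ← hc.eq, mul_assoc, h2, ← pow_succ]

theorem rcancel (z l : Fin n) (hz : z.val = 0) (hl : l.val = n - 1)
    {u v s : Mn n} (h : u * s = v * s) : u = v := by
  obtain ⟨k, t, ht⟩ := dvd_delta z l hz hl s
  have h2 : u * (s * t) = v * (s * t) := by rw [← mul_assoc, h, mul_assoc]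
  have hc := fun x => (delta_comm z l hz hl x).pow_left k
  rw [ht, ← (hc u).eq, ← (hc v).eq] at h2
  exact lcancel _ h2

theorem dvd_delta2 (z l : Fin n) (hz : z.val = 0) (hl : l.val = n - 1)
    (u : Mn n) : ∃ k s, u * s = (o l ^ (n + 1)) ^ k ∧ s * u = (o l ^ (n + 1)) ^ k := by
  obtain ⟨k, s, h⟩ := dvd_delta z l hz hl u
  refine ⟨k, s, h, ?_⟩
  apply lcancel u
  rw [← mul_assoc, h, ((delta_comm z l hz hl u).pow_left k).eq]

/-- two elements right-divide (and left-divide) the same power of Delta -/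
theorem common (z l : Fin n) (hz : z.val = 0) (hl : l.val = n - 1)
    (u v : Mn n) : ∃ d s t : Mn n, u * s = d ∧ s * u = d ∧ v * t = d ∧ t * v = d := by
  obtain ⟨k, s, h1, h2⟩ := dvd_delta2 z l hz hl u
  obtain ⟨k', t, h3, h4⟩ := dvd_delta2 z l hz hl v
  have hc := fun (k : ℕ) x => (delta_comm z l hz hl x).pow_left k
  refine ⟨(o l ^ (n + 1)) ^ (k + k'), s * (o l ^ (n + 1)) ^ k', t * (o l ^ (n + 1)) ^ k,
    ?_, ?_, ?_, ?_⟩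
  · rw [← mul_assoc, h1, ← pow_add]
  · rw [mul_assoc, (hc k' u).eq, ← mul_assoc, h2, ← pow_add]
  · rw [← mul_assoc, h3, ← pow_add, add_comm k]
  · rw [mul_assoc, (hc k v).eq, ← mul_assoc, h4, ← pow_add, add_comm k]

theorem right_lcm (z l : Fin n) (hz : z.val = 0) (hl : l.val = n - 1)
    (u v : Mn n) : ∃ m, IsLcm u v m := by
  obtain ⟨d, s, t, h1, _, h3, _⟩ := common z l hz hl u v
  exact lcm_of_common _ d u v (Nat.lt_succ_self _) ⟨s, h1⟩ ⟨t, h3⟩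

theorem left_lcm (z l : Fin n) (hz : z.val = 0) (hl : l.val = n - 1)
    (u v : Mn n) :
    ∃ m' : Mn n, RDvd u m' ∧ RDvd v m' ∧ ∀ x, RDvd u x → RDvd v x → RDvd m' x := by
  classical
  have hex : ∃ k : ℕ, ∃ m : Mn n, w m = k ∧ RDvd u m ∧ RDvd v m := by
    obtain ⟨d, s, t, _, h2, _, h4⟩ := common z l hz hl u v
    exact ⟨_, d, rfl, ⟨s, h2⟩, ⟨t, h4⟩⟩
  obtain ⟨m, hm, hum, hvm⟩ := Nat.find_spec hex
  have hmin := fun k => Nat.find_min' hex (m := k)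
  refine ⟨m, hum, hvm, ?_⟩
  intro x hux hvx
  obtain ⟨d, s, t, _, h2, _, h4⟩ := common z l hz hl m x
  obtain ⟨p, ⟨h, hp1⟩, ⟨h', hp2⟩, hp⟩ := right_lcm z l hz hl s t
  obtain ⟨g, hg⟩ := hp d ⟨m, h2⟩ ⟨x, h4⟩
  have hmg : m = h * g := by
    apply lcancel s
    rw [h2, ← mul_assoc, hp1, hg]
  have hxg : x = h' * g := by
    apply lcancel t
    rw [h4, ← mul_assoc, hp2, hg]
  have hdiv : ∀ y : Mn n, RDvd y m → RDvd y x → RDvd y g := by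
    rintro y ⟨a, ha⟩ ⟨b, hb⟩
    have hab : s * a = t * b := by
      apply rcancel z l hz hl (s := y)
      rw [mul_assoc, mul_assoc, ha, hb, h2, h4]
    obtain ⟨e, he⟩ := hp (s * a) ⟨a, rfl⟩ ⟨b, hab.symm⟩
    refine ⟨e, lcancel p ?_⟩
    rw [← mul_assoc, he, mul_assoc, ha, h2, hg]
  have hle := hmin (w g) ⟨g, rfl, hdiv u hum hux, hdiv v hvm hvx⟩
  have h0 : h = 1 := by
    apply w_zero
    have := congrArg w hmg
    rw [w_mul] at this
    omega
  rw [h0, one_mul] at hmg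
  exact ⟨h', by rw [hmg, hxg]⟩

end MnAux

/-- Any two elements of `M_n` admit a right-lcm and a left-lcm. -/
theorem stmt10 (n : ℕ) (hn : 1 ≤ n) :
    ∀ u v : Mn n,
      (∃ m : Mn n, LDvd u m ∧ LDvd v m ∧ ∀ w, LDvd u w → LDvd v w → LDvd m w) ∧
      (∃ m' : Mn n, RDvd u m' ∧ RDvd v m' ∧ ∀ w, RDvd u w → RDvd v w → RDvd m' w) := by
  intro u v
  exact ⟨MnAux.right_lcm ⟨0, hn⟩ ⟨n - 1, by omega⟩ rfl rfl u v,
    MnAux.left_lcm ⟨0, hn⟩ ⟨n - 1, by omega⟩ rfl rfl u v⟩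
end
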